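/- arXiv:2107.08138 — 2 statements merged into one kernel-verified Lean document; each statement's English description precedes it below -/
import Mathlib

section
/- Let k > 0 and let D ⊂ ℝ² be a bounded measurable set. Then there exists a constant C > 0 (depending on k and D) such that for every z ∈ ℝ² with dist(z, D) ≥ 1, one has ∫_D | ∫₀^{2π} e^{−ik(z−x)·(cos θ, sin θ)} dθ |² dx ≤ C / dist(z, D). -/
open MeasureTheory

/-- Differentiation of an oscillatory integral with respect to its frequency. -/
lemma hasDerivAt_integral_mul_cos {w φ : ℝ → ℝ} (hw : Continuous w) (hφ : Continuous φ)
    (a b c s : ℝ) :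
    HasDerivAt (fun s => ∫ θ in a..b, w θ * Real.cos (s * φ θ + c))
      (∫ θ in a..b, -(w θ * φ θ * Real.sin (s * φ θ + c))) s := by
  refine (intervalIntegral.hasDerivAt_integral_of_dominated_loc_of_deriv_le
    (F := fun s θ => w θ * Real.cos (s * φ θ + c))
    (F' := fun s θ => -(w θ * φ θ * Real.sin (s * φ θ + c)))
    (bound := fun θ => |w θ * φ θ|) Filter.univ_mem ?_ ?_ ?_ ?_ ?_ ?_).2
  · exact .of_forall fun s => by
      have : Continuous fun θ => w θ * Real.cos (s * φ θ + c) := by fun_prop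
      exact this.aestronglyMeasurable
  · have : Continuous fun θ => w θ * Real.cos (s * φ θ + c) := by fun_prop
    exact this.intervalIntegrable _ _
  · have : Continuous fun θ => -(w θ * φ θ * Real.sin (s * φ θ + c)) := by fun_prop
    exact this.aestronglyMeasurable
  · refine .of_forall fun θ _ s _ => ?_
    rw [norm_neg, norm_mul, Real.norm_eq_abs, Real.norm_eq_abs]
    exact mul_le_of_le_one_right (abs_nonneg _) (Real.abs_sin_le_one _)
  · have : Continuous fun θ => |w θ * φ θ| := by fun_prop
    exact this.intervalIntegrable _ _
  · refine .of_forall fun θ _ s _ => ?_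
    have h : HasDerivAt (fun s => s * φ θ + c) (φ θ) s := by
      simpa using ((hasDerivAt_id s).mul_const (φ θ)).add_const c
    exact (h.cos.const_mul (w θ)).congr_deriv (by ring)

lemma hasDerivAt_integral_mul_sin {w φ : ℝ → ℝ} (hw : Continuous w) (hφ : Continuous φ)
    (a b c s : ℝ) :
    HasDerivAt (fun s => ∫ θ in a..b, w θ * Real.sin (s * φ θ + c))
      (∫ θ in a..b, w θ * φ θ * Real.cos (s * φ θ + c)) s := by
  have h := hasDerivAt_integral_mul_cos hw hφ a b (c - Real.pi / 2) s
  simpa only [← add_sub_assoc, Real.cos_sub_pi_div_two, Real.sin_sub_pi_div_two, mul_neg,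
    neg_neg] using h

/-- A solution of the first-order Bessel system `J' = -K`, `K' = J - K / s` decays like
`s ^ (-1/2)`. -/
lemma sq_le_div_of_bessel_system {J K : ℝ → ℝ} {M : ℝ}
    (hJ : ∀ s, 0 < s → HasDerivAt J (-K s) s)
    (hK : ∀ s, 0 < s → HasDerivAt K (J s - K s / s) s)
    (hJM : ∀ s, |J s| ≤ M) (hKM : ∀ s, |K s| ≤ M) {s : ℝ} (hs : 0 < s) :
    J s ^ 2 ≤ 6 * Real.exp 1 * M ^ 2 / s := by
  have hJM2 : ∀ s, J s ^ 2 ≤ M ^ 2 := fun s => sq_le_sq' (abs_le.1 (hJM s)).1 (abs_le.1 (hJM s)).2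
  have hKM2 : ∀ s, K s ^ 2 ≤ M ^ 2 := fun s => sq_le_sq' (abs_le.1 (hKM s)).1 (abs_le.1 (hKM s)).2
  have he : 1 ≤ Real.exp 1 := Real.one_le_exp zero_le_one
  rw [le_div_iff₀ hs]
  rcases le_total s 1 with h1 | h1
  · nlinarith [hJM2 s, sq_nonneg M, sq_nonneg (J s), mul_le_mul_of_nonneg_right he (sq_nonneg M)]
  set F : ℝ → ℝ := fun s => s * (J s ^ 2 + K s ^ 2) - J s * K s with hF
  have hFd : ∀ s, 0 < s → HasDerivAt F (J s * K s / s) s := fun s hs => by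
    refine (((hasDerivAt_id s).mul (((hJ s hs).pow 2).add ((hK s hs).pow 2))).sub
      ((hJ s hs).mul (hK s hs))).congr_deriv ?_
    simp only [id, Pi.add_apply, Pi.pow_apply]
    field_simp
    ring
  have hGd : ∀ s, 0 < s → HasDerivAt (fun s => F s * Real.exp s⁻¹)
      (J s * K s / s * Real.exp s⁻¹ + F s * (Real.exp s⁻¹ * (-(s ^ 2)⁻¹))) s := fun s hs =>
    (hFd s hs).mul (hasDerivAt_inv hs.ne').exp
  have hanti : AntitoneOn (fun s => F s * Real.exp s⁻¹) (Set.Ici 1) := by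
    refine antitoneOn_of_deriv_nonpos (convex_Ici 1)
      (fun t ht => (hGd t (zero_lt_one.trans_le ht)).continuousAt.continuousWithinAt)
      (fun t ht => ?_) (fun t ht => ?_) <;> rw [interior_Ici, Set.mem_Ioi] at ht <;>
      have ht0 : 0 < t := zero_lt_one.trans ht
    · exact (hGd t ht0).differentiableAt.differentiableWithinAt
    · rw [(hGd t ht0).deriv]
      have hkey : J t * K t * t ≤ F t := by
        simp only [hF]
        nlinarith [sq_nonneg (J t - K t), mul_nonneg ht0.le (sq_nonneg (J t - K t)),
          mul_nonneg (sub_nonneg.2 ht.le) (sq_nonneg (J t)),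
          mul_nonneg (sub_nonneg.2 ht.le) (sq_nonneg (K t))]
      have : J t * K t / t * Real.exp t⁻¹ + F t * (Real.exp t⁻¹ * (-(t ^ 2)⁻¹))
          = -((F t - J t * K t * t) * (Real.exp t⁻¹ / t ^ 2)) := by
        field_simp
        ring
      rw [this]
      exact neg_nonpos.2 (mul_nonneg (sub_nonneg.2 hkey) (by positivity))
  have hle := hanti (Set.mem_Ici.2 le_rfl) (Set.mem_Ici.2 h1) h1
  have hlow : s * J s ^ 2 ≤ 2 * F s := by
    simp only [hF]
    nlinarith [sq_nonneg (J s - K s), mul_nonneg (sub_nonneg.2 h1) (sq_nonneg (J s)),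
      mul_nonneg (sub_nonneg.2 h1) (sq_nonneg (K s))]
  have hFs : 0 ≤ F s := by nlinarith [mul_nonneg hs.le (sq_nonneg (J s))]
  have hFexp : F s ≤ F s * Real.exp s⁻¹ :=
    le_mul_of_one_le_right hFs (Real.one_le_exp (inv_nonneg.2 hs.le))
  have hF1 : F 1 ≤ 3 * M ^ 2 := by
    simp only [hF]
    nlinarith [hJM2 1, hKM2 1, sq_nonneg (J 1 + K 1)]
  simp only [inv_one] at hle
  nlinarith [mul_le_mul_of_nonneg_right hF1 (Real.exp_pos 1).le]

/-- The plane-wave average over the unit circle with frequency `s` and phase shift `c` decays like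
`s ^ (-1/2)`. -/
lemma sq_integral_cos_le {a b : ℝ} (hab : a ^ 2 + b ^ 2 = 1) (c : ℝ) {s : ℝ} (hs : 0 < s) :
    (∫ θ in (0 : ℝ)..(2 * Real.pi),
      Real.cos (s * (a * Real.cos θ + b * Real.sin θ) + c)) ^ 2
      ≤ 6 * Real.exp 1 * (2 * Real.pi) ^ 2 / s := by
  set φ : ℝ → ℝ := fun θ => a * Real.cos θ + b * Real.sin θ with hφ
  set ψ : ℝ → ℝ := fun θ => b * Real.cos θ - a * Real.sin θ with hψ
  have hφc : Continuous φ := by fun_prop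
  have hψc : Continuous ψ := by fun_prop
  have hφd : ∀ θ, HasDerivAt φ (ψ θ) θ := fun θ =>
    (((Real.hasDerivAt_cos θ).const_mul a).add ((Real.hasDerivAt_sin θ).const_mul b)).congr_deriv
      (by simp only [hψ]; ring)
  have hψd : ∀ θ, HasDerivAt ψ (-φ θ) θ := fun θ =>
    (((Real.hasDerivAt_cos θ).const_mul b).sub ((Real.hasDerivAt_sin θ).const_mul a)).congr_deriv
      (by simp only [hφ]; ring)
  have hsum : ∀ θ, φ θ ^ 2 + ψ θ ^ 2 = 1 := fun θ => by
    simp only [hφ, hψ]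
    linear_combination (a ^ 2 + b ^ 2) * Real.sin_sq_add_cos_sq θ + hab
  have hφ1 : ∀ θ, |φ θ| ≤ 1 := fun θ =>
    (sq_le_one_iff_abs_le_one _).1 (by nlinarith [hsum θ, sq_nonneg (ψ θ)])
  have hbound : ∀ f : ℝ → ℝ, (∀ θ, |f θ| ≤ 1) →
      |∫ θ in (0 : ℝ)..(2 * Real.pi), f θ| ≤ 2 * Real.pi := fun f hf => by
    have h := intervalIntegral.norm_integral_le_of_norm_le_const (a := 0) (b := 2 * Real.pi)
      (f := f) (C := 1) fun θ _ => hf θ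
    rwa [sub_zero, one_mul, abs_of_pos Real.two_pi_pos] at h
  -- Integration by parts, using `φ = -ψ'` and periodicity.
  have hparts : ∀ s : ℝ, ∫ θ in (0 : ℝ)..(2 * Real.pi), φ θ * Real.sin (s * φ θ + c)
      = s * ∫ θ in (0 : ℝ)..(2 * Real.pi), ψ θ ^ 2 * Real.cos (s * φ θ + c) := fun s => by
    have hd : ∀ θ, HasDerivAt (fun θ => ψ θ * Real.sin (s * φ θ + c))
        (s * (ψ θ ^ 2 * Real.cos (s * φ θ + c)) - φ θ * Real.sin (s * φ θ + c)) θ := fun θ =>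
      ((hψd θ).mul (((hφd θ).const_mul s).add_const c).sin).congr_deriv (by ring)
    have h := intervalIntegral.integral_eq_sub_of_hasDerivAt (a := 0) (b := 2 * Real.pi)
      (fun θ _ => hd θ) (Continuous.intervalIntegrable (by fun_prop) _ _)
    rw [intervalIntegral.integral_sub (Continuous.intervalIntegrable (by fun_prop) _ _)
      (Continuous.intervalIntegrable (by fun_prop) _ _),
      intervalIntegral.integral_const_mul] at h
    simp only [hφ, hψ, Real.cos_two_pi, Real.sin_two_pi, Real.cos_zero, Real.sin_zero,
      sub_self] at h ⊢
    linarith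
  refine sq_le_div_of_bessel_system
    (J := fun s => ∫ θ in (0 : ℝ)..(2 * Real.pi), Real.cos (s * φ θ + c))
    (K := fun s => ∫ θ in (0 : ℝ)..(2 * Real.pi), φ θ * Real.sin (s * φ θ + c))
    (fun s _ => ?_) (fun s hs => ?_) (fun s => hbound _ fun θ => Real.abs_cos_le_one _)
    (fun s => hbound _ fun θ => ?_) hs
  · simpa only [one_mul, intervalIntegral.integral_neg] using
      hasDerivAt_integral_mul_cos (w := fun _ => 1) continuous_const hφc 0 (2 * Real.pi) c s
  · refine (hasDerivAt_integral_mul_sin hφc hφc 0 (2 * Real.pi) c s).congr_deriv ?_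
    rw [hparts s, mul_div_cancel_left₀ _ hs.ne', ← intervalIntegral.integral_sub
      (Continuous.intervalIntegrable (by fun_prop) _ _)
      (Continuous.intervalIntegrable (by fun_prop) _ _)]
    refine intervalIntegral.integral_congr fun θ _ => ?_
    linear_combination Real.cos (s * φ θ + c) * hsum θ
  · rw [abs_mul]
    exact mul_le_one₀ (hφ1 θ) (abs_nonneg _) (Real.abs_sin_le_one _)

lemma norm_sq_integral_exp_le {a b k : ℝ} (hk : 0 < k) {r : ℝ} (hr : 0 < r)
    (hab : a ^ 2 + b ^ 2 = r ^ 2) :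
    ‖∫ θ in (0 : ℝ)..(2 * Real.pi),
        Complex.exp (-Complex.I * k * ((a * Real.cos θ + b * Real.sin θ : ℝ) : ℂ))‖ ^ 2
      ≤ 12 * Real.exp 1 * (2 * Real.pi) ^ 2 / (k * r) := by
  have hab' : (a / r) ^ 2 + (b / r) ^ 2 = 1 := by
    rw [div_pow, div_pow, ← add_div, hab, div_self (pow_ne_zero 2 hr.ne')]
  have hcos := sq_integral_cos_le hab' 0 (mul_pos hk hr)
  have hsin := sq_integral_cos_le hab' (-(Real.pi / 2)) (mul_pos hk hr)
  have hscale : ∀ θ, k * r * (a / r * Real.cos θ + b / r * Real.sin θ)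
      = k * (a * Real.cos θ + b * Real.sin θ) := fun θ => by field_simp
  simp only [hscale, add_zero, ← sub_eq_add_neg, Real.cos_sub_pi_div_two] at hcos hsin
  have hexp : ∀ θ : ℝ,
      Complex.exp (-Complex.I * k * ((a * Real.cos θ + b * Real.sin θ : ℝ) : ℂ))
        = ((Real.cos (k * (a * Real.cos θ + b * Real.sin θ)) : ℝ) : ℂ)
          - ((Real.sin (k * (a * Real.cos θ + b * Real.sin θ)) : ℝ) : ℂ) * Complex.I := fun θ => by
    rw [Complex.ofReal_cos, Complex.ofReal_sin, Complex.cos_sub_sin_I]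
    congr 1
    push_cast
    ring
  simp only [hexp]
  rw [intervalIntegral.integral_sub (Continuous.intervalIntegrable (by fun_prop) _ _)
    (Continuous.intervalIntegrable (by fun_prop) _ _), intervalIntegral.integral_mul_const,
    intervalIntegral.integral_ofReal, intervalIntegral.integral_ofReal, ← Complex.normSq_eq_norm_sq,
    Complex.normSq_apply]
  simp only [Complex.sub_re, Complex.sub_im, Complex.mul_re, Complex.mul_im, Complex.ofReal_re,
    Complex.ofReal_im, Complex.I_re, Complex.I_im]
  have : 12 * Real.exp 1 * (2 * Real.pi) ^ 2 / (k * r)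
      = 6 * Real.exp 1 * (2 * Real.pi) ^ 2 / (k * r)
        + 6 * Real.exp 1 * (2 * Real.pi) ^ 2 / (k * r) := by ring
  rw [this]
  nlinarith [hcos, hsin]

/-- Quantitative decay of the `L²(D)` norm of the Herglotz-type function in 2D:
`∫_D |∫₀^{2π} e^{−ik(z−x)·(cos θ, sin θ)} dθ|² dx ≤ C / dist(z,D)` for `dist(z,D) ≥ 1`. -/
theorem herglotz_L2_decay_two_dim (k : ℝ) (hk : 0 < k)
    (D : Set (EuclideanSpace ℝ (Fin 2)))
    (hD : Bornology.IsBounded D) (hDm : MeasurableSet D) :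
    ∃ C > 0, ∀ z : EuclideanSpace ℝ (Fin 2), 1 ≤ Metric.infDist z D →
      ∫ x in D,
          ‖∫ θ in (0 : ℝ)..(2 * Real.pi),
              Complex.exp (-Complex.I * k *
                (((z - x) 0 * Real.cos θ + (z - x) 1 * Real.sin θ : ℝ) : ℂ))‖ ^ 2
        ≤ C / Metric.infDist z D := by
  set A : ℝ := 12 * Real.exp 1 * (2 * Real.pi) ^ 2 / k with hA
  have hApos : 0 < A := by positivity
  refine ⟨A * volume.real D + 1, by positivity, fun z hz => ?_⟩
  have hd : 0 < Metric.infDist z D := zero_lt_one.trans_le hz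
  have hpt : ∀ x ∈ D, ‖‖∫ θ in (0 : ℝ)..(2 * Real.pi), Complex.exp (-Complex.I * k *
      (((z - x) 0 * Real.cos θ + (z - x) 1 * Real.sin θ : ℝ) : ℂ))‖ ^ 2‖
        ≤ A / Metric.infDist z D := fun x hx => by
    have hle : Metric.infDist z D ≤ ‖z - x‖ := by
      rw [← dist_eq_norm]
      exact Metric.infDist_le_dist_of_mem hx
    have hsq : (z - x) 0 ^ 2 + (z - x) 1 ^ 2 = ‖z - x‖ ^ 2 := by
      rw [EuclideanSpace.real_norm_sq_eq, Fin.sum_univ_two]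
    rw [norm_pow, norm_norm]
    refine (norm_sq_integral_exp_le hk (hd.trans_le hle) hsq).trans ?_
    rw [← div_div]
    exact div_le_div_of_nonneg_left hApos.le hd hle
  refine (Real.le_norm_self _).trans
    ((norm_setIntegral_le_of_norm_le_const hD.measure_lt_top hpt).trans ?_)
  rw [div_mul_eq_mul_div]
  gcongr
  exact le_add_of_nonneg_right zero_le_one
end

section
/- Let k > 0 and 0 < r < R. Then there exists a constant C > 0 (depending on k, r, R) such that for every z ∈ ℝ³ with |z| < R and every x ∈ ℝ³ with |x| ≤ r, one has | ∫_{|y|=R} ( e^{ik|x−y|}/(4π|x−y|) ) · conj( e^{ik|z−y|}/(4π|z−y|) ) dσ(y) | ≤ C. -/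
open MeasureTheory

/-- The 3D fundamental solution of the Helmholtz equation `Φ(x,y) = e^{ik|x−y|}/(4π|x−y|)`. -/
noncomputable def Phi (k : ℝ) (x y : EuclideanSpace ℝ (Fin 3)) : ℂ :=
  Complex.exp (Complex.I * k * ‖x - y‖) / ((4 * Real.pi * ‖x - y‖ : ℝ) : ℂ)

/-- If closed balls around `z` have at most quadratic measure growth, then `1 / dist z ·` has
bounded integral over a set of points at distance at most `ρ` from `z`. -/
theorem lintegral_inv_dist_le_of_measure_closedBall_le {X : Type*} [PseudoMetricSpace X]
    [MeasurableSpace X] [OpensMeasurableSpace X] {μ : Measure X} {z : X} {c ρ : ℝ}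
    (hc : 0 ≤ c) (hρ : 0 < ρ)
    (hball : ∀ t, 0 < t → μ (Metric.closedBall z t) ≤ ENNReal.ofReal (c * t ^ 2))
    (hdist : ∀ᵐ y ∂μ, dist z y ≤ ρ) :
    ∫⁻ y, ENNReal.ofReal (dist z y)⁻¹ ∂μ ≤ ENNReal.ofReal (4 * c * ρ) := by
  have hpt : ∀ᵐ y ∂μ, ENNReal.ofReal (dist z y)⁻¹ ≤
      ∑' n : ℕ, (Metric.closedBall z (ρ * (1 / 2) ^ n)).indicator
        (fun _ => ENNReal.ofReal (2 ^ (n + 1) / ρ)) y := by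
    filter_upwards [hdist] with y hy
    rcases (dist_nonneg (x := z) (y := y)).eq_or_lt with h0 | h0
    · simp [← h0]
    obtain ⟨n, hn1, hn2⟩ := exists_nat_pow_near_of_lt_one (x := dist z y / ρ)
      (y := (1 / 2 : ℝ)) (by positivity) ((div_le_one hρ).2 hy) (by norm_num) (by norm_num)
    refine le_trans ?_ (ENNReal.le_tsum n)
    have hmem : y ∈ Metric.closedBall z (ρ * (1 / 2) ^ n) := by
      rw [Metric.mem_closedBall, dist_comm]
      rwa [div_le_iff₀' hρ] at hn2
    rw [Set.indicator_of_mem hmem]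
    apply ENNReal.ofReal_le_ofReal
    rw [lt_div_iff₀ hρ] at hn1
    calc (dist z y)⁻¹ ≤ ((1 / 2) ^ (n + 1) * ρ)⁻¹ := inv_anti₀ (by positivity) hn1.le
      _ = 2 ^ (n + 1) / ρ := by
        rw [mul_inv, one_div, inv_pow, inv_inv, div_eq_mul_inv]
  have hsum : HasSum (fun n : ℕ => 2 * c * ρ * (1 / 2 : ℝ) ^ n) (4 * c * ρ) := by
    have h := hasSum_geometric_two.mul_left (2 * c * ρ)
    rwa [show 2 * c * ρ * 2 = 4 * c * ρ by ring] at h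
  calc ∫⁻ y, ENNReal.ofReal (dist z y)⁻¹ ∂μ
      ≤ ∫⁻ y, ∑' n : ℕ, (Metric.closedBall z (ρ * (1 / 2) ^ n)).indicator
          (fun _ => ENNReal.ofReal (2 ^ (n + 1) / ρ)) y ∂μ := lintegral_mono_ae hpt
    _ = ∑' n : ℕ, ENNReal.ofReal (2 ^ (n + 1) / ρ) *
          μ (Metric.closedBall z (ρ * (1 / 2) ^ n)) := by
        rw [lintegral_tsum fun n =>
          (measurable_const.indicator measurableSet_closedBall).aemeasurable]
        simp_rw [lintegral_indicator_const measurableSet_closedBall]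
    _ ≤ ∑' n : ℕ, ENNReal.ofReal (2 * c * ρ * (1 / 2 : ℝ) ^ n) := by
        refine ENNReal.tsum_le_tsum fun n => ?_
        calc _ ≤ ENNReal.ofReal (2 ^ (n + 1) / ρ) *
              ENNReal.ofReal (c * (ρ * (1 / 2) ^ n) ^ 2) := by
              gcongr
              exact hball _ (by positivity)
          _ = _ := by
              rw [← ENNReal.ofReal_mul (by positivity)]
              congr 1
              have h : (2 : ℝ) ^ n * (1 / 2) ^ n = 1 := by
                rw [← mul_pow]; norm_num
              calc 2 ^ (n + 1) / ρ * (c * (ρ * (1 / 2) ^ n) ^ 2)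
                  = 2 * c * (ρ ^ 2 / ρ) * (1 / 2) ^ n * (2 ^ n * (1 / 2) ^ n) := by ring
                _ = 2 * c * ρ * (1 / 2) ^ n := by
                    rw [h, mul_one, pow_two, mul_div_cancel_right₀ _ hρ.ne']
    _ = ENNReal.ofReal (4 * c * ρ) := by
        rw [← ENNReal.ofReal_tsum_of_nonneg (fun n => by positivity) hsum.summable, hsum.tsum_eq]

/-- The part of the sphere of radius `R` on which `ε` times the `i`-th coordinate dominates the
absolute values of all coordinates. -/
def spherePatch (R ε : ℝ) (i : Fin 3) : Set (EuclideanSpace ℝ (Fin 3)) :=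
  {y | ‖y‖ = R ∧ ∀ j, |y j| ≤ ε * y i}

theorem sphere_subset_iUnion_spherePatch (R : ℝ) :
    Metric.sphere (0 : EuclideanSpace ℝ (Fin 3)) R ⊆
      ⋃ i, (spherePatch R 1 i ∪ spherePatch R (-1) i) := by
  intro y hy
  obtain ⟨i, hi⟩ := Finite.exists_max fun j => |y j|
  have hn : ‖y‖ = R := by simpa using hy
  refine Set.mem_iUnion.2 ⟨i, ?_⟩
  rcases abs_choice (y i) with h | h
  · exact Or.inl ⟨hn, fun j => by simpa [h] using hi j⟩
  · exact Or.inr ⟨hn, fun j => by simpa [h] using hi j⟩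

/-- Forgetting the dominating coordinate is antilipschitz on a patch of the sphere. -/
theorem antilipschitzWith_spherePatch_succAbove (R : ℝ) {ε : ℝ} (hε : ε ^ 2 = 1) (i : Fin 3) :
    AntilipschitzWith 4 fun (y : spherePatch R ε i) (j : Fin 2) =>
      (y : EuclideanSpace ℝ (Fin 3)) (i.succAbove j) := by
  refine AntilipschitzWith.of_le_mul_dist ?_
  rintro ⟨y, hyR, hy⟩ ⟨w, hwR, hw⟩
  set d := dist (fun j : Fin 2 => y (i.succAbove j)) (fun j : Fin 2 => w (i.succAbove j)) with hd
  have hd0 : 0 ≤ d := dist_nonneg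
  have hj : ∀ j : Fin 2, |y (i.succAbove j) - w (i.succAbove j)| ≤ d := fun j => by
    rw [← Real.dist_eq]
    exact dist_le_pi_dist (fun j : Fin 2 => y (i.succAbove j)) (fun j => w (i.succAbove j)) j
  have hsq : y i ^ 2 + ∑ j : Fin 2, y (i.succAbove j) ^ 2 =
      w i ^ 2 + ∑ j : Fin 2, w (i.succAbove j) ^ 2 := by
    rw [← Fin.sum_univ_succAbove (fun j => y j ^ 2) i,
      ← Fin.sum_univ_succAbove (fun j => w j ^ 2) i,
      ← EuclideanSpace.real_norm_sq_eq, ← EuclideanSpace.real_norm_sq_eq, hyR, hwR]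
  have hi : |y i - w i| ≤ 2 * d := by
    have ha : 0 ≤ ε * y i := (abs_nonneg _).trans (hy i)
    have hb : 0 ≤ ε * w i := (abs_nonneg _).trans (hw i)
    have hterm : ∀ j : Fin 2, |w (i.succAbove j) ^ 2 - y (i.succAbove j) ^ 2| ≤
        d * (ε * y i + ε * w i) := fun j => by
      have h1 : |y (i.succAbove j) + w (i.succAbove j)| ≤ ε * y i + ε * w i :=
        (abs_add_le _ _).trans (add_le_add (hy _) (hw _))
      rw [abs_sub_comm, sq_sub_sq, abs_mul, mul_comm]
      exact mul_le_mul (hj j) h1 (abs_nonneg _) hd0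
    have hmul : |y i - w i| * (ε * y i + ε * w i) ≤ 2 * d * (ε * y i + ε * w i) := by
      have habs : |ε| = 1 := by rw [← sq_abs] at hε; nlinarith [abs_nonneg ε]
      calc |y i - w i| * (ε * y i + ε * w i)
          = |y i - w i| * |ε * (y i + w i)| := by
            rw [abs_of_nonneg (a := ε * (y i + w i)) (by linarith)]; ring
        _ = |y i ^ 2 - w i ^ 2| := by
            rw [abs_mul, habs, one_mul, ← abs_mul]; congr 1; ring
        _ = |∑ j : Fin 2, (w (i.succAbove j) ^ 2 - y (i.succAbove j) ^ 2)| := by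
            rw [Finset.sum_sub_distrib]; congr 1; linarith
        _ ≤ ∑ j : Fin 2, |w (i.succAbove j) ^ 2 - y (i.succAbove j) ^ 2| :=
            Finset.abs_sum_le_sum_abs _ _
        _ ≤ ∑ _j : Fin 2, d * (ε * y i + ε * w i) := Finset.sum_le_sum fun j _ => hterm j
        _ = 2 * d * (ε * y i + ε * w i) := by simp; ring
    rcases (add_nonneg ha hb).eq_or_lt with h | h
    · have hy0 : |y i| ≤ 0 := (hy i).trans (by linarith)
      have hw0 : |w i| ≤ 0 := (hw i).trans (by linarith)
      rw [abs_nonpos_iff.1 hy0, abs_nonpos_iff.1 hw0]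
      simpa using hd0
    · exact le_of_mul_le_mul_right hmul h
  change dist y w ≤ ((4 : NNReal) : ℝ) * d
  rw [EuclideanSpace.dist_eq]
  apply Real.sqrt_le_iff.2
  refine ⟨by positivity, ?_⟩
  rw [Fin.sum_univ_succAbove _ i, Fin.sum_univ_two]
  simp only [Real.dist_eq]
  have h0 := pow_le_pow_left₀ (abs_nonneg _) (hj 0) 2
  have h1 := pow_le_pow_left₀ (abs_nonneg _) (hj 1) 2
  have h2 := pow_le_pow_left₀ (abs_nonneg _) hi 2
  push_cast
  nlinarith [sq_nonneg d]

theorem hausdorffMeasure_spherePatch_inter_closedBall_le (R : ℝ) {ε : ℝ} (hε : ε ^ 2 = 1)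
    (i : Fin 3) (z : EuclideanSpace ℝ (Fin 3)) {t : ℝ} (ht : 0 < t) :
    μH[2] (spherePatch R ε i ∩ Metric.closedBall z t) ≤ ENNReal.ofReal (64 * t ^ 2) := by
  have himage : (fun (y : spherePatch R ε i) (j : Fin 2) =>
      (y : EuclideanSpace ℝ (Fin 3)) (i.succAbove j)) ''
        (Subtype.val ⁻¹' Metric.closedBall z t) ⊆
      Metric.closedBall (fun j : Fin 2 => z (i.succAbove j)) t := by
    rintro _ ⟨y, hy, rfl⟩
    refine (dist_pi_le_iff ht.le).2 fun j => ?_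
    have hyz : dist (y : EuclideanSpace ℝ (Fin 3)) z ≤ t := hy
    rw [dist_eq_norm] at hyz ⊢
    exact (PiLp.norm_apply_le ((y : EuclideanSpace ℝ (Fin 3)) - z) (i.succAbove j)).trans hyz
  have hvol : (μH[2] : Measure (Fin 2 → ℝ)) = volume := by
    simpa using hausdorffMeasure_pi_real (ι := Fin 2)
  rw [← Subtype.image_preimage_coe,
    isometry_subtype_coe.hausdorffMeasure_image (Or.inl zero_le_two)]
  calc _ ≤ ((4 : NNReal) : ENNReal) ^ (2 : ℝ) * μH[2] _ :=
        (antilipschitzWith_spherePatch_succAbove R hε i).le_hausdorffMeasure_image zero_le_two _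
    _ ≤ ((4 : NNReal) : ENNReal) ^ (2 : ℝ) *
          μH[2] (Metric.closedBall (fun j : Fin 2 => z (i.succAbove j)) t) := by
        gcongr
    _ = ENNReal.ofReal (64 * t ^ 2) := by
        rw [hvol, Real.volume_pi_closedBall _ ht.le]
        have h4 : ((4 : NNReal) : ENNReal) ^ (2 : ℝ) = ENNReal.ofReal 16 := by
          rw [ENNReal.rpow_ofNat, ENNReal.ofReal_ofNat]
          norm_num
        rw [h4, ← ENNReal.ofReal_mul (by norm_num), Fintype.card_fin]
        congr 1
        ring

theorem hausdorffMeasure_sphere_inter_closedBall_le (R : ℝ) (z : EuclideanSpace ℝ (Fin 3))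
    {t : ℝ} (ht : 0 < t) :
    (μH[2] : Measure (EuclideanSpace ℝ (Fin 3))).restrict (Metric.sphere 0 R)
      (Metric.closedBall z t) ≤ ENNReal.ofReal (384 * t ^ 2) := by
  rw [Measure.restrict_apply measurableSet_closedBall]
  calc _ ≤ μH[2] (⋃ i, ((spherePatch R 1 i ∩ Metric.closedBall z t) ∪
          (spherePatch R (-1) i ∩ Metric.closedBall z t))) := by
        refine measure_mono fun y hy => ?_
        simpa [← and_or_right, hy.1] using
          And.intro (Set.mem_iUnion.1 (sphere_subset_iUnion_spherePatch R hy.2)) hy.1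
    _ ≤ ∑ _i : Fin 3, (ENNReal.ofReal (64 * t ^ 2) + ENNReal.ofReal (64 * t ^ 2)) := by
        refine (measure_iUnion_fintype_le _ _).trans (Finset.sum_le_sum fun i _ => ?_)
        exact (measure_union_le _ _).trans (add_le_add
          (hausdorffMeasure_spherePatch_inter_closedBall_le R (by norm_num) i z ht)
          (hausdorffMeasure_spherePatch_inter_closedBall_le R (by norm_num) i z ht))
    _ = ENNReal.ofReal (384 * t ^ 2) := by
        rw [← ENNReal.ofReal_add (by positivity) (by positivity),
          ← ENNReal.ofReal_sum_of_nonneg fun _ _ => by positivity]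
        congr 1
        simp
        ring

theorem norm_Phi_le (k : ℝ) (x y : EuclideanSpace ℝ (Fin 3)) : ‖Phi k x y‖ ≤ (dist x y)⁻¹ := by
  have hexp : ‖Complex.exp (Complex.I * k * ‖x - y‖)‖ = 1 := by
    rw [mul_assoc, mul_comm, ← Complex.ofReal_mul, Complex.norm_exp_ofReal_mul_I]
  rw [Phi, norm_div, hexp, Complex.norm_real, Real.norm_of_nonneg (by positivity), one_div,
    mul_inv, dist_eq_norm]
  refine mul_le_of_le_one_left (by positivity) (inv_le_one_of_one_le₀ ?_)
  linarith [Real.pi_gt_three]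

/-- Uniform boundedness of the single-layer potential applied to the density
`conj(Φ(·,z))` on the sphere of radius `R`:
`|∫_{|y|=R} Φ(x,y) conj(Φ(z,y)) dσ(y)| ≤ C` uniformly for `|x| ≤ r` and `|z| < R`. -/
theorem single_layer_potential_uniform_bound (k r R : ℝ) (hk : 0 < k) (hr : 0 < r)
    (hrR : r < R) :
    ∃ C > 0, ∀ z : EuclideanSpace ℝ (Fin 3), ‖z‖ < R →
      ∀ x : EuclideanSpace ℝ (Fin 3), ‖x‖ ≤ r →
        ‖∫ y in Metric.sphere (0 : EuclideanSpace ℝ (Fin 3)) R,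
            Phi k x y * (starRingEnd ℂ) (Phi k z y) ∂(μH[2])‖ ≤ C := by
  have hR : 0 < R := hr.trans hrR
  have hgap : 0 < R - r := sub_pos.2 hrR
  refine ⟨(R - r)⁻¹ * (4 * 384 * (2 * R)), by positivity, fun z hz x hx => ?_⟩
  have hsphere : ∀ᵐ y ∂(μH[2] : Measure (EuclideanSpace ℝ (Fin 3))).restrict
      (Metric.sphere 0 R), ‖y‖ = R := by
    filter_upwards [ae_restrict_mem Metric.isClosed_sphere.measurableSet] with y hy
    simpa using hy
  have hz_int := lintegral_inv_dist_le_of_measure_closedBall_le (z := z) (c := 384)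
    (ρ := 2 * R) (by norm_num) (by positivity)
    (fun t ht => hausdorffMeasure_sphere_inter_closedBall_le R z ht) (by
      filter_upwards [hsphere] with y hy
      rw [dist_eq_norm]
      linarith [norm_sub_le z y])
  refine (norm_integral_le_lintegral_norm _).trans
    (ENNReal.toReal_le_of_le_ofReal (by positivity) ?_)
  calc _ ≤ ∫⁻ y in Metric.sphere (0 : EuclideanSpace ℝ (Fin 3)) R,
          ENNReal.ofReal (R - r)⁻¹ * ENNReal.ofReal (dist z y)⁻¹ ∂(μH[2]) := by
        refine lintegral_mono_ae ?_
        filter_upwards [hsphere] with y hy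
        rw [← ENNReal.ofReal_mul (by positivity), norm_mul, RCLike.norm_conj]
        have hxy : R - r ≤ dist x y := by
          rw [dist_comm, dist_eq_norm]
          linarith [norm_sub_norm_le y x]
        gcongr
        · exact (norm_Phi_le k x y).trans (inv_anti₀ hgap hxy)
        · exact norm_Phi_le k z y
    _ = ENNReal.ofReal (R - r)⁻¹ * ∫⁻ y in Metric.sphere (0 : EuclideanSpace ℝ (Fin 3)) R,
          ENNReal.ofReal (dist z y)⁻¹ ∂(μH[2]) :=
        lintegral_const_mul' _ _ ENNReal.ofReal_ne_top
    _ ≤ ENNReal.ofReal ((R - r)⁻¹ * (4 * 384 * (2 * R))) := by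
        rw [ENNReal.ofReal_mul (by positivity)]
        gcongr
end
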